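/- arXiv:2605.27639 — 11 statements merged into one kernel-verified Lean document; each statement's English description precedes it below -/
import Mathlib

section
/- Let m be a positive integer. A pair of integers (x, y) satisfies m·x·y = x + y + m (equivalently, x·y = τ(x+y) + 1 with τ = 1/m) if and only if there exists an integer d dividing m² + 1 with d ≡ -1 (mod m) such that m·x = d + 1 and m·y = (m² + 1)/d + 1. -/
/-- For a positive integer `m`, an integer pair `(x, y)` satisfies
`m*x*y = x + y + m` (i.e., `x*y = τ*(x+y) + 1` with `τ = 1/m`) if and only if there is an
integer divisor `d` of `m^2 + 1` with `d ≡ -1 (mod m)` such that `m*x = d + 1` and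
`m*y = (m^2 + 1)/d + 1`. -/
theorem stmt_0 (m x y : ℤ) (hm : 0 < m) :
    m * x * y = x + y + m ↔
      ∃ d : ℤ, d ∣ m ^ 2 + 1 ∧ d ≡ -1 [ZMOD m] ∧
        m * x = d + 1 ∧ m * y = (m ^ 2 + 1) / d + 1 := by
  constructor
  · intro h
    have key : m ^ 2 + 1 = (m * x - 1) * (m * y - 1) := by linear_combination -m * h
    have hd : m * x - 1 ≠ 0 := by
      intro h0
      rw [h0, zero_mul] at key
      nlinarith [sq_nonneg m]
    refine ⟨m * x - 1, ⟨m * y - 1, key⟩, ?_, by ring, ?_⟩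
    · exact (Int.modEq_iff_dvd.mpr ⟨x, by ring⟩).symm
    · rw [key, Int.mul_ediv_cancel_left _ hd]
      ring
  · rintro ⟨d, hd, -, hx, hy⟩
    have key := Int.mul_ediv_cancel' hd
    apply mul_left_cancel₀ hm.ne'
    linear_combination (m * y - 1) * hx + d * hy + key
end

section
/- Let θ be a real number with 0 < θ < π and set τ = tan(θ/2), and assume τ > 0. If x and y are real numbers satisfying x·y = τ(x + y) + 1, and a = y + 1/τ, b = x + 1/τ, c = x + y, then c² = a² + b² − 2·a·b·cos(θ). (Thus (a, b, c) satisfies the law of cosines for a triangle with angle θ between the sides a and b.) -/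
/-- If `0 < θ < π`, `τ = tan(θ/2) > 0`, and real numbers `x, y` satisfy
`x*y = τ*(x+y) + 1`, then with `a = y + 1/τ`, `b = x + 1/τ`, `c = x + y` we have
`c² = a² + b² − 2*a*b*cos θ` (law of cosines with angle `θ` between sides `a` and `b`). -/
theorem stmt_2 (θ τ x y a b c : ℝ) (hθ0 : 0 < θ) (hθπ : θ < Real.pi)
    (hτ : τ = Real.tan (θ / 2)) (hτpos : 0 < τ)
    (hxy : x * y = τ * (x + y) + 1)
    (ha : a = y + 1 / τ) (hb : b = x + 1 / τ) (hc : c = x + y) :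
    c ^ 2 = a ^ 2 + b ^ 2 - 2 * a * b * Real.cos θ := by
  have hcos : Real.cos θ ≠ -1 := by
    have h := Real.cos_lt_cos_of_nonneg_of_le_pi hθ0.le le_rfl hθπ
    rw [Real.cos_pi] at h
    exact h.ne'
  rw [Real.cos_eq_two_mul_tan_half_div_one_sub_tan_half_sq θ hcos, ← hτ, ha, hb, hc]
  have hden : 1 + τ ^ 2 ≠ 0 := by positivity
  field_simp
  linear_combination 4 * τ ^ 2 * hxy
end

section
/- Let τ be a positive rational number and let x, y be rational numbers satisfying x·y = τ(x + y) + 1. Set a = y + 1/τ and b = x + 1/τ. Then the area n = (1/2)·a·b·(2τ/(1 + τ²)) satisfies n = x·y/τ, and moreover n equals the semiperimeter s = x + y + 1/τ of the triangle with sides (a, b, x + y) (so the inradius of this triangle equals 1). In particular n = τ·x·y·(1/τ)², so n is τ·x·y up to a nonzero rational square. -/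
/-- For positive rational `τ` and rationals `x, y` with `x*y = τ*(x+y) + 1`,
setting `a = y + 1/τ`, `b = x + 1/τ`, the area `n = (1/2)*a*b*(2τ/(1+τ²))` satisfies
`n = x*y/τ`, `n` equals the semiperimeter `x + y + 1/τ` of the triangle with sides
`(a, b, x+y)`, and `n = τ*x*y*(1/τ)²` (so `n` is `τ*x*y` up to a nonzero rational square). -/
theorem stmt_4 (τ x y a b n : ℚ) (hτ : 0 < τ)
    (hxy : x * y = τ * (x + y) + 1)
    (ha : a = y + 1 / τ) (hb : b = x + 1 / τ)
    (hn : n = (1 / 2) * a * b * (2 * τ / (1 + τ ^ 2))) :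
    n = x * y / τ ∧ n = x + y + 1 / τ ∧ n = τ * x * y * (1 / τ) ^ 2 := by
  have hτ0 : τ ≠ 0 := hτ.ne'
  have hden : 1 + τ ^ 2 ≠ 0 := by positivity
  have hab : a * b = x * y * (1 + τ ^ 2) / τ ^ 2 := by
    rw [ha, hb]
    field_simp
    linear_combination -hxy
  have harea : n = x * y / τ := by
    rw [hn, mul_assoc (1 / 2) a b, hab]
    field_simp
  refine ⟨harea, ?_, ?_⟩
  · rw [harea, hxy]
    field_simp
  · rw [harea]
    field_simp
end

section
/- Let a, u, v be positive rational numbers. The line L = {(X, Y) ∈ ℝ² : X/u + Y/v = 1} intersects the ellipse E_a = {(X, Y) ∈ ℝ² : (X − a)²/a² + a²·(Y − 1/a)² = 1} in exactly one point if and only if there exist rational numbers x and y with x·y = x + y + 1, u = a(x + 1), and v = (y + 1)/a. -/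
/-- A line meets the unit circle in exactly one point iff its distance to the origin is `1`. -/
theorem existsUnique_line_inter_unitCircle_iff {p q c : ℝ} (h : p ^ 2 + q ^ 2 ≠ 0) :
    (∃! z : ℝ × ℝ, p * z.1 + q * z.2 = c ∧ z.1 ^ 2 + z.2 ^ 2 = 1) ↔ c ^ 2 = p ^ 2 + q ^ 2 := by
  constructor
  · rintro ⟨⟨s, t⟩, ⟨hl, hc⟩, huniq⟩
    dsimp only at hl hc
    -- the reflection of `(s, t)` in the normal of the line is again a common point
    have hr := huniq (2 * c * p / (p ^ 2 + q ^ 2) - s, 2 * c * q / (p ^ 2 + q ^ 2) - t) (by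
      subst hl
      constructor
      · dsimp only
        field_simp
        ring
      · rw [← hc]
        dsimp only
        field_simp
        ring)
    obtain ⟨hs, ht⟩ := Prod.mk.inj hr
    have hs' : c * p = (p ^ 2 + q ^ 2) * s := by
      field_simp at hs
      linarith
    have ht' : c * q = (p ^ 2 + q ^ 2) * t := by
      field_simp at ht
      linarith
    apply mul_right_cancel₀ h
    linear_combination (c * p + (p ^ 2 + q ^ 2) * s) * hs' +
      (c * q + (p ^ 2 + q ^ 2) * t) * ht' + (p ^ 2 + q ^ 2) ^ 2 * hc
  · intro hc
    refine ⟨(c * p / (p ^ 2 + q ^ 2), c * q / (p ^ 2 + q ^ 2)), ⟨?_, ?_⟩, ?_⟩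
    · dsimp only
      field_simp
    · dsimp only
      field_simp
      linear_combination hc
    · rintro ⟨s, t⟩ ⟨hl, h1⟩
      dsimp only at hl h1
      have hn : p * t - q * s = 0 := by
        apply pow_eq_zero_iff (two_ne_zero) |>.mp
        linear_combination (p ^ 2 + q ^ 2) * h1 - (p * s + q * t + c) * hl - hc
      refine Prod.ext ?_ ?_
      · dsimp only
        field_simp
        linear_combination p * hl - q * hn
      · dsimp only
        field_simp
        linear_combination q * hl + p * hn

/-- The affine change of coordinates `(X, Y) ↦ (X / a - 1, a Y - 1)`, which takes the ellipse
centered at `(a, 1 / a)` with semi-axes `a` and `1 / a` to the unit circle. -/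
noncomputable def ellipseToCircle (a : ℝ) (ha : a ≠ 0) : ℝ × ℝ ≃ ℝ × ℝ where
  toFun z := (z.1 / a - 1, a * z.2 - 1)
  invFun z := (a * (z.1 + 1), (z.2 + 1) / a)
  left_inv z := by ext <;> field_simp <;> ring
  right_inv z := by ext <;> field_simp <;> ring

/-- The line with nonzero intercepts `u` and `v` is tangent to the ellipse centered at
`(a, 1 / a)` with semi-axes `a` and `1 / a` iff `a (u v + 2) = 2 (u + a² v)`. -/
theorem existsUnique_line_inter_ellipse_iff {a u v : ℝ} (ha : a ≠ 0) (hu : u ≠ 0) (hv : v ≠ 0) :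
    (∃! z : ℝ × ℝ, z.1 / u + z.2 / v = 1 ∧
        (z.1 - a) ^ 2 / a ^ 2 + a ^ 2 * (z.2 - 1 / a) ^ 2 = 1) ↔
      a * (u * v + 2) = 2 * (u + a ^ 2 * v) := by
  have hn : (a ^ 2 * v) ^ 2 + u ^ 2 ≠ 0 := by positivity
  have key := existsUnique_line_inter_unitCircle_iff (c := a * u * v - u - a ^ 2 * v) hn
  have hcongr : (∃! z : ℝ × ℝ, z.1 / u + z.2 / v = 1 ∧
        (z.1 - a) ^ 2 / a ^ 2 + a ^ 2 * (z.2 - 1 / a) ^ 2 = 1) ↔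
      ∃! z : ℝ × ℝ, a ^ 2 * v * z.1 + u * z.2 = a * u * v - u - a ^ 2 * v ∧
        z.1 ^ 2 + z.2 ^ 2 = 1 := by
    refine (ellipseToCircle a ha).existsUnique_congr fun {z} => and_congr ?_ ?_
    · have hl : a ^ 2 * v * (z.1 / a - 1) + u * (a * z.2 - 1) - (a * u * v - u - a ^ 2 * v) =
          a * u * v * (z.1 / u + z.2 / v - 1) := by
        field_simp
        ring
      change _ ↔ a ^ 2 * v * (z.1 / a - 1) + u * (a * z.2 - 1) = _
      rw [← sub_eq_zero, ← sub_eq_zero (b := a * u * v - u - a ^ 2 * v), hl]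
      simp [ha, hu, hv]
    · have he : (z.1 / a - 1) ^ 2 + (a * z.2 - 1) ^ 2 =
          (z.1 - a) ^ 2 / a ^ 2 + a ^ 2 * (z.2 - 1 / a) ^ 2 := by
        field_simp
      change _ ↔ (z.1 / a - 1) ^ 2 + (a * z.2 - 1) ^ 2 = 1
      rw [he]
  rw [hcongr, key]
  constructor
  · intro h
    apply mul_left_cancel₀ (mul_ne_zero (mul_ne_zero ha hu) hv)
    linear_combination h
  · intro h
    linear_combination a * u * v * h

/-- For positive rationals `a, u, v`, the line `X/u + Y/v = 1` meets the ellipse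
`E_a : (X−a)²/a² + a²(Y−1/a)² = 1` in exactly one point if and only if there are rationals
`x, y` with `x*y = x + y + 1`, `u = a(x+1)`, `v = (y+1)/a`. -/
theorem stmt_5 (a u v : ℚ) (ha : 0 < a) (hu : 0 < u) (hv : 0 < v) :
    (∃! p : ℝ × ℝ,
        p.1 / (u : ℝ) + p.2 / (v : ℝ) = 1 ∧
        (p.1 - (a : ℝ)) ^ 2 / (a : ℝ) ^ 2 + (a : ℝ) ^ 2 * (p.2 - 1 / (a : ℝ)) ^ 2 = 1) ↔
      ∃ x y : ℚ, x * y = x + y + 1 ∧ u = a * (x + 1) ∧ v = (y + 1) / a := by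
  have hu' : (u : ℝ) ≠ 0 := by exact_mod_cast hu.ne'
  have hv' : (v : ℝ) ≠ 0 := by exact_mod_cast hv.ne'
  have ha' : (a : ℝ) ≠ 0 := by exact_mod_cast ha.ne'
  rw [existsUnique_line_inter_ellipse_iff ha' hu' hv']
  have ha₀ := ha.ne'
  constructor
  · intro h
    have h' : a * (u * v + 2) = 2 * (u + a ^ 2 * v) := by exact_mod_cast h
    refine ⟨u / a - 1, a * v - 1, ?_, ?_, ?_⟩
    · field_simp
      linear_combination h'
    · field_simp
      ring
    · field_simp
      ring
  · rintro ⟨x, y, hxy, rfl, rfl⟩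
    have h' : a * (a * (x + 1) * ((y + 1) / a) + 2) =
        2 * (a * (x + 1) + a ^ 2 * ((y + 1) / a)) := by
      field_simp
      linear_combination hxy
    exact_mod_cast h'
end

section
/- For every positive integer t, the number t(t + 1)(t + 2) is a congruent number; that is, there exist positive rational numbers a, b, c with a² + b² = c² and (1/2)·a·b = t(t + 1)(t + 2). In other words, the product of any three consecutive positive integers is a congruent number. -/
/-- For every positive integer `t`, the product `t(t+1)(t+2)` of three
consecutive positive integers is a congruent number: there are positive rationals
`a, b, c` with `a² + b² = c²` and `(1/2)*a*b = t(t+1)(t+2)`. -/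
theorem stmt_8 (t : ℕ) (ht : 0 < t) :
    ∃ a b c : ℚ, 0 < a ∧ 0 < b ∧ 0 < c ∧ a ^ 2 + b ^ 2 = c ^ 2 ∧
      (1 / 2) * a * b = (t : ℚ) * (t + 1) * (t + 2) := by
  have ht' : (0 : ℚ) < t := by exact_mod_cast ht
  refine ⟨t * (t + 2), 2 * (t + 1), (t + 1) ^ 2 + 1, by positivity, by positivity,
    by positivity, by ring, by ring⟩
end

section
/- Let a, b, c be positive rational numbers with a² + b² = c², and suppose the a-exradius equals 1, i.e., a·b/(−a + b + c) = 1 (equivalently a − b + c = 2). Then there exist rational numbers x and z satisfying z − z·x − x = 1 such that a = x + 1, b = z − 1, and c = z − x. -/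
/-- If a rational right triangle `(a, b, c)` has `a`-exradius equal to `1`,
i.e. `a*b/(−a+b+c) = 1`, then there are rationals `x, z` with `z − z*x − x = 1` such that
`a = x + 1`, `b = z − 1`, `c = z − x`. -/
theorem stmt_12 (a b c : ℚ) (ha : 0 < a) (hb : 0 < b) (hc : 0 < c)
    (hpyth : a ^ 2 + b ^ 2 = c ^ 2)
    (hra : a * b / (-a + b + c) = 1) :
    ∃ x z : ℚ, z - z * x - x = 1 ∧ a = x + 1 ∧ b = z - 1 ∧ c = z - x := by
  have hs : -a + b + c ≠ 0 := by
    intro h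
    simp [h] at hra
  have hab : a * b = -a + b + c := by
    rwa [div_eq_one_iff_eq hs] at hra
  have hsum : a - b + c = 2 := by
    apply mul_left_cancel₀ hs
    linear_combination 2 * hab - hpyth
  refine ⟨a - 1, b + 1, ?_, by ring, by ring, ?_⟩
  · linear_combination -hab - hsum
  · linear_combination hsum
end

section
/- Let a, b, c be positive rational numbers with a² + b² = c², and suppose the b-exradius equals 1, i.e., a·b/(a − b + c) = 1 (equivalently −a + b + c = 2). Then there exist rational numbers x and z satisfying z(x − 1) + x + 1 = 0 such that a = z − 1, b = x + 1, and c = z − x. -/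
/-- If a rational right triangle `(a, b, c)` has `b`-exradius equal to `1`,
i.e. `a*b/(a−b+c) = 1`, then there are rationals `x, z` with `z(x−1) + x + 1 = 0` such that
`a = z − 1`, `b = x + 1`, `c = z − x`. -/
theorem stmt_13 (a b c : ℚ) (ha : 0 < a) (hb : 0 < b) (hc : 0 < c)
    (hpyth : a ^ 2 + b ^ 2 = c ^ 2)
    (hrb : a * b / (a - b + c) = 1) :
    ∃ x z : ℚ, z * (x - 1) + x + 1 = 0 ∧ a = z - 1 ∧ b = x + 1 ∧ c = z - x := by
  have hd : a - b + c ≠ 0 := by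
    intro h
    simp [h] at hrb
  have hab : a * b = a - b + c := by rwa [div_eq_one_iff_eq hd] at hrb
  have hsum : -a + b + c = 2 := by
    apply mul_left_cancel₀ hd
    linear_combination 2 * hab - hpyth
  exact ⟨b - 1, a + 1, by linear_combination hab + hsum, by ring, by ring,
    by linear_combination hsum⟩
end

section
/- Let a, b, c be rational numbers. Then (a, b, c) is a rational right triangle with c-exradius equal to 1 — that is, a, b, c > 0, a² + b² = c², and a + b + c = 2 — if and only if there exist rational numbers x, y with 0 < x < 1, 0 < y < 1, and x·y + x + y = 1, such that a = 1 − y, b = 1 − x, and c = x + y. Moreover, in this case a + b > c, a + c > b, b + c > a, and c is the largest side. -/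
/-- `(a, b, c)` is a rational right triangle with `c`-exradius `1`
(`a, b, c > 0`, `a² + b² = c²`, `a + b + c = 2`) iff there are rationals `x, y` with
`0 < x < 1`, `0 < y < 1`, `x*y + x + y = 1`, `a = 1 − y`, `b = 1 − x`, `c = x + y`.
Moreover in this case the triangle inequalities hold and `c` is the largest side. -/
theorem stmt_14 (a b c : ℚ) :
    ((0 < a ∧ 0 < b ∧ 0 < c ∧ a ^ 2 + b ^ 2 = c ^ 2 ∧ a + b + c = 2) ↔
      ∃ x y : ℚ, 0 < x ∧ x < 1 ∧ 0 < y ∧ y < 1 ∧ x * y + x + y = 1 ∧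
        a = 1 - y ∧ b = 1 - x ∧ c = x + y) ∧
    ((0 < a ∧ 0 < b ∧ 0 < c ∧ a ^ 2 + b ^ 2 = c ^ 2 ∧ a + b + c = 2) →
      a + b > c ∧ a + c > b ∧ b + c > a ∧ a < c ∧ b < c) := by
  have legs_lt : (0 < a ∧ 0 < b ∧ 0 < c ∧ a ^ 2 + b ^ 2 = c ^ 2 ∧ a + b + c = 2) →
      a < c ∧ b < c := by
    rintro ⟨ha, hb, hc, h, -⟩
    exact ⟨lt_of_pow_lt_pow_left₀ 2 hc.le (by linarith [pow_pos hb 2]),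
      lt_of_pow_lt_pow_left₀ 2 hc.le (by linarith [pow_pos ha 2])⟩
  refine ⟨⟨fun H => ?_, ?_⟩, fun H => ?_⟩
  · obtain ⟨hac, hbc⟩ := legs_lt H
    obtain ⟨ha, hb, hc, h, hs⟩ := H
    obtain rfl : c = 2 - a - b := by linarith
    exact ⟨1 - b, 1 - a, by linarith, by linarith, by linarith, by linarith, by linarith,
      by ring, by ring, by ring⟩
  · rintro ⟨x, y, hx, hx1, hy, hy1, h, rfl, rfl, rfl⟩
    exact ⟨by linarith, by linarith, by linarith, by linarith, by ring⟩
  · obtain ⟨hac, hbc⟩ := legs_lt H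
    obtain ⟨ha, hb, hc, h, hs⟩ := H
    refine ⟨lt_of_pow_lt_pow_left₀ 2 (by linarith) ?_, by linarith, by linarith, hac, hbc⟩
    linarith [mul_pos ha hb, add_sq a b]
end

section
/- Let x be a rational number with 0 < x < 1 and set y = (1 − x)/(1 + x). Then a = 1 − y = 2x/(1 + x), b = 1 − x, and c = x + y = (1 + x²)/(1 + x) are positive rationals satisfying a² + b² = c² and a + b + c = 2 (so the c-exradius equals 1), and the area of this rational right triangle is a·b/2 = x(1 − x)/(1 + x). Consequently x(1 − x)(1 + x) is a congruent number up to a nonzero rational square. -/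
/-- For rational `x` with `0 < x < 1` and `y = (1−x)/(1+x)`, the numbers
`a = 1 − y = 2x/(1+x)`, `b = 1 − x`, `c = x + y = (1+x²)/(1+x)` form a rational right
triangle of perimeter `2` (so `c`-exradius `1`) with area `a*b/2 = x(1−x)/(1+x)`;
consequently `x(1−x)(1+x)` is a congruent number up to a nonzero rational square. -/
theorem stmt_17 (x y a b c : ℚ) (hx0 : 0 < x) (hx1 : x < 1)
    (hy : y = (1 - x) / (1 + x))
    (ha : a = 1 - y) (hb : b = 1 - x) (hc : c = x + y) :
    a = 2 * x / (1 + x) ∧ c = (1 + x ^ 2) / (1 + x) ∧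
    0 < a ∧ 0 < b ∧ 0 < c ∧ a ^ 2 + b ^ 2 = c ^ 2 ∧ a + b + c = 2 ∧
    a * b / 2 = x * (1 - x) / (1 + x) ∧
    ∃ q : ℚ, q ≠ 0 ∧ x * (1 - x) * (1 + x) = (a * b / 2) * q ^ 2 := by
  have h : 0 < 1 + x := by linarith
  have h' : 1 + x ≠ 0 := h.ne'
  have h1 : 0 < 1 - x := sub_pos.mpr hx1
  have ha' : a = 2 * x / (1 + x) := by
    rw [ha, hy]
    field_simp
    ring
  have hc' : c = (1 + x ^ 2) / (1 + x) := by
    rw [hc, hy]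
    field_simp
    ring
  have area : a * b / 2 = x * (1 - x) / (1 + x) := by
    rw [ha', hb]
    field_simp
  refine ⟨ha', hc', ?_, hb ▸ h1, ?_, ?_, ?_, area, 1 + x, h', ?_⟩
  · rw [ha']
    positivity
  · rw [hc']
    positivity
  · rw [ha', hb, hc']
    field_simp
    ring
  · rw [ha, hb, hc]
    ring
  · rw [area]
    field_simp
end

section
/- Let x be a rational number with 0 < x < 1. Then a = x + 1, b = 2x/(1 − x), and c = (1 + x²)/(1 − x) are positive rationals satisfying a² + b² = c² and a·b/(−a + b + c) = 1 (so the a-exradius equals 1), and the area of this rational right triangle is a·b/2 = x(x + 1)/(1 − x). Consequently x(x + 1)(1 − x) is a congruent number up to a nonzero rational square. -/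
/-- For rational `x` with `0 < x < 1`, the numbers `a = x + 1`,
`b = 2x/(1−x)`, `c = (1+x²)/(1−x)` form a rational right triangle with `a`-exradius `1`
(`a*b/(−a+b+c) = 1`) and area `a*b/2 = x(x+1)/(1−x)`; consequently `x(x+1)(1−x)` is a
congruent number up to a nonzero rational square. -/
theorem stmt_18 (x a b c : ℚ) (hx0 : 0 < x) (hx1 : x < 1)
    (ha : a = x + 1) (hb : b = 2 * x / (1 - x)) (hc : c = (1 + x ^ 2) / (1 - x)) :
    0 < a ∧ 0 < b ∧ 0 < c ∧ a ^ 2 + b ^ 2 = c ^ 2 ∧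
    a * b / (-a + b + c) = 1 ∧
    a * b / 2 = x * (x + 1) / (1 - x) ∧
    ∃ q : ℚ, q ≠ 0 ∧ x * (x + 1) * (1 - x) = (a * b / 2) * q ^ 2 := by
  subst ha hb hc
  have hd : 0 < 1 - x := sub_pos.mpr hx1
  have hd' : 1 - x ≠ 0 := hd.ne'
  have hx : 0 < x + 1 := by linarith
  have hr : -(x + 1) + 2 * x / (1 - x) + (1 + x ^ 2) / (1 - x) =
      (x + 1) * (2 * x / (1 - x)) := by
    field_simp
    ring
  refine ⟨hx, by positivity, by positivity, ?_, ?_, ?_, 1 - x, hd', ?_⟩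
  · field_simp
    ring
  · rw [hr]
    exact div_self (by positivity)
  · ring
  · field_simp
end

section
/- For every positive rational number t, the triple (u, v, w) with u = t + 2, v = 2(t + 1)/t, and w = t + 2 + 2/t consists of positive rationals satisfying u² + v² = w², and the area of this rational right triangle is u·v/2 = (t + 1)(t + 2)/t. Consequently t(t + 1)(t + 2) is a congruent number up to a nonzero rational square, for every positive rational t. -/
/-- For every positive rational `t`, the triple `u = t + 2`,
`v = 2(t+1)/t`, `w = t + 2 + 2/t` is a rational right triangle with area
`u*v/2 = (t+1)(t+2)/t`; consequently `t(t+1)(t+2)` is a congruent number up to a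
nonzero rational square. -/
theorem stmt_19 (t u v w : ℚ) (ht : 0 < t)
    (hu : u = t + 2) (hv : v = 2 * (t + 1) / t) (hw : w = t + 2 + 2 / t) :
    0 < u ∧ 0 < v ∧ 0 < w ∧ u ^ 2 + v ^ 2 = w ^ 2 ∧
    u * v / 2 = (t + 1) * (t + 2) / t ∧
    ∃ q : ℚ, q ≠ 0 ∧ t * (t + 1) * (t + 2) = (u * v / 2) * q ^ 2 := by
  subst hu hv hw
  refine ⟨by positivity, by positivity, by positivity, ?_, by field_simp, t, ht.ne', by field_simp⟩
  field_simp
  ring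
end
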